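/- (Theorem 3.3 of the paper) Let K/k be a finite Galois extension with Galois group G, V a finite-dimensional k-vector space, and T a family of tensors on V, i.e. a subset T ⊆ ⊕_{p,q} V^{⊗p} ⊗_k (V^*)^{⊗q} (equivalently, tensors x_i of types (p_i,q_i)). Let A_{T,K} be the group of K-linear automorphisms of V_K fixing x_K for every x ∈ T, with G acting by f ↦ s(f) = s ∘ f ∘ s⁻¹. Let E_{V,T}(K/k) be the set of k-isomorphism classes of pairs (V', T') that become isomorphic to (V, T) over K. Then the map θ : E_{V,T}(K/k) → H¹(G, A_{T,K}), sending the class of (V',T') to the class of the 1-cocycle s ↦ f⁻¹ ∘ s(f), where f : V_K → V'_K is any K-linear isomorphism carrying each x_K (x ∈ T) to the corresponding tensor of T', is well defined and bijective. -/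

import Mathlib

open TensorProduct

noncomputable section

universe u

/-! ### Tensor spaces of type `(p, q)` -/

section TensorSpace

variable (F : Type u) [Field F] (W : Type u) [AddCommGroup W] [Module F W] (p q : ℕ)

/-- The `i`-th factor of the tensor space `W^{⊗p} ⊗ (W^*)^{⊗q}`. -/
def TensorFactor : Fin p ⊕ Fin q → Type u := fun i =>
  match i with
  | Sum.inl _ => W
  | Sum.inr _ => Module.Dual F W

instance (i : Fin p ⊕ Fin q) : AddCommGroup (TensorFactor F W p q i) :=
  match i with
  | Sum.inl _ => inferInstanceAs (AddCommGroup W)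
  | Sum.inr _ => inferInstanceAs (AddCommGroup (Module.Dual F W))

instance (i : Fin p ⊕ Fin q) : Module F (TensorFactor F W p q i) :=
  match i with
  | Sum.inl _ => inferInstanceAs (Module F W)
  | Sum.inr _ => inferInstanceAs (Module F (Module.Dual F W))

/-- The space of tensors of type `(p, q)` on `W`: `W^{⊗p} ⊗ (W^*)^{⊗q}`. -/
def TensorSpace : Type u := ⨂[F] i : Fin p ⊕ Fin q, TensorFactor F W p q i

instance : AddCommGroup (TensorSpace F W p q) :=
  inferInstanceAs (AddCommGroup (⨂[F] i : Fin p ⊕ Fin q, TensorFactor F W p q i))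

instance : Module F (TensorSpace F W p q) :=
  inferInstanceAs (Module F (⨂[F] i : Fin p ⊕ Fin q, TensorFactor F W p q i))

variable {F p q}

/-- The equivalence of tensor spaces of type `(p, q)` induced by a linear
equivalence `e : W ≃ W'` (acting by `e` on each factor `W` and by the
contragredient of `e` on each factor `W^*`). -/
def tensorCongr {W W' : Type u} [AddCommGroup W] [Module F W]
    [AddCommGroup W'] [Module F W']
    (e : W ≃ₗ[F] W') : TensorSpace F W p q ≃ₗ[F] TensorSpace F W' p q :=
  PiTensorProduct.congr fun i =>
    match i with
    | Sum.inl _ => e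
    | Sum.inr _ => e.symm.dualMap

end TensorSpace

/-! ### Base change of tensors -/

section BaseChange

variable (k K : Type u) [Field k] [Field K] [Algebra k K]
variable (V : Type u) [AddCommGroup V] [Module k V] (p q : ℕ)

/-- The canonical map `V → K ⊗[k] V`, `v ↦ 1 ⊗ v`. -/
def inclBC : V →ₗ[k] K ⊗[k] V := TensorProduct.mk k K V 1

/-- Base change of linear functionals: `f : V → k` extends to
`f_K : K ⊗[k] V → K`. -/
def dualBC : Module.Dual k V →ₗ[k] Module.Dual K (K ⊗[k] V) :=
  (((LinearMap.liftBaseChangeEquiv K).toLinearMap).restrictScalars k) ∘ₗ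
    (LinearMap.llcomp k V k K (Algebra.linearMap k K))

instance (i : Fin p ⊕ Fin q) : Module k (TensorFactor K (K ⊗[k] V) p q i) :=
  match i with
  | Sum.inl _ => inferInstanceAs (Module k (K ⊗[k] V))
  | Sum.inr _ => inferInstanceAs (Module k (Module.Dual K (K ⊗[k] V)))

instance (i : Fin p ⊕ Fin q) : IsScalarTower k K (TensorFactor K (K ⊗[k] V) p q i) :=
  match i with
  | Sum.inl _ => inferInstanceAs (IsScalarTower k K (K ⊗[k] V))
  | Sum.inr _ => inferInstanceAs (IsScalarTower k K (Module.Dual K (K ⊗[k] V)))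

instance : Module k (TensorSpace K (K ⊗[k] V) p q) :=
  inferInstanceAs (Module k (⨂[K] i : Fin p ⊕ Fin q, TensorFactor K (K ⊗[k] V) p q i))

/-- Base change on each factor of a tensor space. -/
def factorBC : ∀ i : Fin p ⊕ Fin q,
    TensorFactor k V p q i →ₗ[k] TensorFactor K (K ⊗[k] V) p q i := fun i =>
  match i with
  | Sum.inl _ => inclBC k K V
  | Sum.inr _ => dualBC k K V

/-- Base change of tensors of type `(p, q)`: the canonical map
`V^{⊗p} ⊗ (V^*)^{⊗q} → (V_K)^{⊗p} ⊗_K (V_K^*)^{⊗q}`, `x ↦ x_K`. -/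
def tensorBC : TensorSpace k V p q →ₗ[k] TensorSpace K (K ⊗[k] V) p q :=
  PiTensorProduct.lift
    (((PiTensorProduct.tprod K).restrictScalars k).compLinearMap (factorBC k K V p q))

end BaseChange

/-! ### The semilinear Galois action and conjugation -/

section GaloisConjugation

variable {k K : Type u} [Field k] [Field K] [Algebra k K]
variable {V W : Type u} [AddCommGroup V] [Module k V] [AddCommGroup W] [Module k W]

/-- The semilinear Galois action on the base change `K ⊗[k] V`, as a
`k`-linear equivalence: `s (λ ⊗ v) = s λ ⊗ v`. -/
def galAct (s : K ≃ₐ[k] K) : K ⊗[k] V ≃ₗ[k] K ⊗[k] V :=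
  TensorProduct.congr s.toLinearEquiv (LinearEquiv.refl k V)

lemma galAct_tmul (s : K ≃ₐ[k] K) (a : K) (v : V) :
    galAct s (a ⊗ₜ[k] v) = s a ⊗ₜ[k] v := rfl

lemma galAct_smul (s : K ≃ₐ[k] K) (c : K) (x : K ⊗[k] V) :
    galAct s (c • x) = s c • galAct s x := by
  induction x using TensorProduct.induction_on with
  | zero => simp
  | tmul a v =>
      rw [TensorProduct.smul_tmul', galAct_tmul, galAct_tmul, TensorProduct.smul_tmul',
        smul_eq_mul, smul_eq_mul, map_mul]
  | add x y hx hy => simp [smul_add, map_add, hx, hy]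

lemma galAct_galAct (s : K ≃ₐ[k] K) (x : K ⊗[k] V) :
    galAct s (galAct s.symm x) = x := by
  induction x using TensorProduct.induction_on with
  | zero => simp
  | tmul a v => rw [galAct_tmul, galAct_tmul]; simp
  | add x y hx hy => simp [map_add, hx, hy]

lemma galAct_galAct' (s : K ≃ₐ[k] K) (x : K ⊗[k] V) :
    galAct s.symm (galAct s x) = x := by
  conv_rhs => rw [← galAct_galAct s.symm x]
  simp

/-- Conjugation `f ↦ s(f) = s ∘ f ∘ s⁻¹` of a `K`-linear map between base
changes by the semilinear Galois action. -/
def galConjMap (s : K ≃ₐ[k] K) (f : (K ⊗[k] V) →ₗ[K] (K ⊗[k] W)) :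
    (K ⊗[k] V) →ₗ[K] (K ⊗[k] W) where
  toFun x := galAct s (f (galAct s.symm x))
  map_add' x y := by simp
  map_smul' c x := by
    simp only [RingHom.id_apply]
    rw [galAct_smul s.symm, map_smul, galAct_smul s]
    simp

/-- Conjugation `f ↦ s(f) = s ∘ f ∘ s⁻¹` of a `K`-linear equivalence between
base changes by the semilinear Galois action. -/
def galConj (s : K ≃ₐ[k] K) (f : (K ⊗[k] V) ≃ₗ[K] (K ⊗[k] W)) :
    (K ⊗[k] V) ≃ₗ[K] (K ⊗[k] W) :=
  { galConjMap s f.toLinearMap with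
    invFun := fun y => galAct s (f.symm (galAct s.symm y))
    left_inv := fun x => by
      simp [galConjMap, galAct_galAct', galAct_galAct]
    right_inv := fun y => by
      simp [galConjMap, galAct_galAct', galAct_galAct] }

end GaloisConjugation

/-! ### The statement -/

section Statement

variable (k K : Type u) [Field k] [Field K] [Algebra k K] [IsGalois k K]
  [FiniteDimensional k K]

/-- A finite-dimensional `k`-vector space equipped with a family of tensors
`x_i` of types `(p_i, q_i)`, indexed by `ι`. -/
structure TensorFamilyPair (k : Type u) [Field k] (ι : Type u)
    (p q : ι → ℕ) : Type (u + 1) where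
  carrier : Type u
  [acg : AddCommGroup carrier]
  [mod : Module k carrier]
  [fd : FiniteDimensional k carrier]
  tensor : ∀ i : ι, TensorSpace k carrier (p i) (q i)

attribute [instance] TensorFamilyPair.acg TensorFamilyPair.mod TensorFamilyPair.fd

variable {V : Type u} [AddCommGroup V] [Module k V] [FiniteDimensional k V]
variable {ι : Type u} {p q : ι → ℕ}

variable (V ι p q) in
/-- `f : V_K ≃ V'_K` is a `K`-isomorphism from `(V, T)` to `(V', T')`,
i.e. it carries each `(x_i)_K` to the corresponding tensor `(x'_i)_K`. -/
def IsTensorIsoK (T : ∀ i : ι, TensorSpace k V (p i) (q i))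
    (P : TensorFamilyPair k ι p q)
    (f : (K ⊗[k] V) ≃ₗ[K] (K ⊗[k] P.carrier)) : Prop :=
  ∀ i : ι, tensorCongr f (tensorBC k K V (p i) (q i) (T i)) =
    tensorBC k K P.carrier (p i) (q i) (P.tensor i)

variable (V ι p q) in
/-- The pair `(V', T')` becomes isomorphic to `(V, T)` over `K`. -/
def BecomesIsomorphic (T : ∀ i : ι, TensorSpace k V (p i) (q i))
    (P : TensorFamilyPair k ι p q) : Prop :=
  ∃ f : (K ⊗[k] V) ≃ₗ[K] (K ⊗[k] P.carrier), IsTensorIsoK k K V ι p q T P f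

/-- `k`-isomorphism of pairs `(V', T')`. -/
def kIsomorphic (P P' : TensorFamilyPair k ι p q) : Prop :=
  ∃ e : P.carrier ≃ₗ[k] P'.carrier, ∀ i : ι, tensorCongr e (P.tensor i) = P'.tensor i

variable (V ι p q) in
/-- The set `E_{V,T}(K/k)` of `k`-isomorphism classes of pairs `(V', T')`
that become isomorphic to `(V, T)` over `K`. -/
def TensorClasses (T : ∀ i : ι, TensorSpace k V (p i) (q i)) : Type (u + 1) :=
  Quot (fun P P' : {P : TensorFamilyPair k ι p q //
    BecomesIsomorphic k K V ι p q T P} => kIsomorphic k P.1 P'.1)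

variable (V ι p q) in
/-- The conditions defining a 1-cocycle of `G = Gal(K/k)` in the group
`A_{T,K}` of `K`-automorphisms of `V_K` fixing every `(x_i)_K` (this group
being unfolded as a subgroup of the `K`-linear automorphism group of `V_K`),
for the conjugation action `f ↦ s(f) = s ∘ f ∘ s⁻¹`. -/
def IsTensorCocycle (T : ∀ i : ι, TensorSpace k V (p i) (q i))
    (a : (K ≃ₐ[k] K) → ((K ⊗[k] V) ≃ₗ[K] (K ⊗[k] V))) : Prop :=
  (∀ s : K ≃ₐ[k] K, ∀ i : ι,
      tensorCongr (a s) (tensorBC k K V (p i) (q i) (T i)) =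
        tensorBC k K V (p i) (q i) (T i)) ∧
    ∀ s t : K ≃ₐ[k] K, a (s * t) = a s * galConj s (a t)

variable (V ι p q) in
/-- Two 1-cocycles in `A_{T,K}` are cohomologous. -/
def TensorCohomologous (T : ∀ i : ι, TensorSpace k V (p i) (q i))
    (a b : (K ≃ₐ[k] K) → ((K ⊗[k] V) ≃ₗ[K] (K ⊗[k] V))) : Prop :=
  ∃ c : (K ⊗[k] V) ≃ₗ[K] (K ⊗[k] V),
    (∀ i : ι, tensorCongr c (tensorBC k K V (p i) (q i) (T i)) =
      tensorBC k K V (p i) (q i) (T i)) ∧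
    ∀ s : K ≃ₐ[k] K, b s = c⁻¹ * a s * galConj s c

variable (V ι p q) in
/-- The nonabelian cohomology set `H¹(Gal(K/k), A_{T,K})`. -/
def TensorH1 (T : ∀ i : ι, TensorSpace k V (p i) (q i)) : Type u :=
  Quot (fun a b : {a : (K ≃ₐ[k] K) → ((K ⊗[k] V) ≃ₗ[K] (K ⊗[k] V)) //
    IsTensorCocycle k K V ι p q T a} => TensorCohomologous k K V ι p q T a.1 b.1)

end Statement

section AuxDescent

lemma aux_sum_mem {k K M : Type*} [Field k] [Field K] [Algebra k K] [IsGalois k K]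
    [FiniteDimensional k K] [AddCommGroup M] [Module K M] [Module k M] [IsScalarTower k K M]
    (σ : (K ≃ₐ[k] K) → M →+ M) (hσ : ∀ s (c : K) x, σ s (c • x) = s c • σ s x)
    (N : Submodule k M) (hN : ∀ s, ∀ y ∈ N, σ s y = y) (c : K) (y : M) (hy : y ∈ N) :
    (∑ s, σ s (c • y)) = Algebra.trace k K c • y := by
  simp only [hσ, hN _ y hy, ← Finset.sum_smul]
  rw [← trace_eq_sum_automorphisms, algebraMap_smul]

lemma aux_fixed_mem {k K M : Type*} [Field k] [Field K] [Algebra k K] [IsGalois k K]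
    [FiniteDimensional k K] [AddCommGroup M] [Module K M] [Module k M] [IsScalarTower k K M]
    (σ : (K ≃ₐ[k] K) → M →+ M) (hσ : ∀ s (c : K) x, σ s (c • x) = s c • σ s x)
    (N : Submodule k M) (hN : ∀ s, ∀ y ∈ N, σ s y = y)
    (hspan : ∀ z, z ∈ Submodule.span K (N : Set M))
    (x : M) (hx : ∀ s, σ s x = x) : x ∈ N := by
  have key : ∀ z : M, (∑ s, σ s z) ∈ N := by
    intro z
    have hz := hspan z
    induction hz using Submodule.closure_induction with
    | zero => simp
    | add a b _ _ ha hb => simp only [map_add, Finset.sum_add_distrib]; exact N.add_mem ha hb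
    | smul_mem c y hy =>
      rw [aux_sum_mem σ hσ N hN c y hy]
      exact N.smul_mem _ hy
  obtain ⟨μ, hμ⟩ := Algebra.trace_surjective k K 1
  have := key (μ • x)
  simp only [hσ, hx, ← Finset.sum_smul] at this
  rw [← trace_eq_sum_automorphisms, hμ] at this
  simpa using this

open Classical in
lemma aux_dual_basis (k K : Type*) [Field k] [Field K] [Algebra k K] [IsGalois k K]
    [FiniteDimensional k K] : ∃ (n : ℕ) (l m : Fin n → K),
      (∀ x : K, ∑ i, Algebra.trace k K (l i * x) • m i = x) ∧
      (∀ s : K ≃ₐ[k] K, ∑ i, m i * s (l i) = if s = 1 then 1 else 0) := by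
  let b := Module.finBasis k K
  have h1 : ∀ x : K, ∑ i, Algebra.trace k K (b i * x) • b.traceDual i = x := by
    intro x
    conv_rhs => rw [← b.traceDual.sum_repr x]
    refine Finset.sum_congr rfl fun i _ => ?_
    rw [Module.Basis.traceDual_repr_apply, Algebra.traceForm_apply, mul_comm]
  refine ⟨_, b, b.traceDual, h1, ?_⟩
  have hli : LinearIndependent K (fun s : K ≃ₐ[k] K => ((s : K →* K) : K → K)) := by
    refine (linearIndependent_monoidHom K K).comp (fun s : K ≃ₐ[k] K => (s : K →* K)) ?_
    intro s t h
    ext x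
    exact DFunLike.congr_fun h x
  rw [Fintype.linearIndependent_iff] at hli
  intro s
  have := hli (fun s => ∑ i, b.traceDual i * s (b i) - if s = 1 then 1 else 0) ?_ s
  · exact sub_eq_zero.mp this
  funext x
  simp only [Finset.sum_apply, Pi.smul_apply, smul_eq_mul, sub_mul, Finset.sum_sub_distrib,
    Pi.zero_apply, ite_mul, one_mul, zero_mul, Finset.sum_ite_eq',
    Finset.mem_univ, if_true]
  rw [sub_eq_zero]
  have h2 := h1 x
  simp only [Algebra.smul_def, trace_eq_sum_automorphisms, map_mul] at h2
  refine Eq.trans ?_ (h2.trans rfl)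
  simp only [Finset.sum_mul]
  rw [Finset.sum_comm]
  refine Finset.sum_congr rfl fun i _ => Finset.sum_congr rfl fun t _ => ?_
  simp; ring

lemma aux_descent {k K M : Type*} [Field k] [Field K] [Algebra k K] [IsGalois k K]
    [FiniteDimensional k K] [AddCommGroup M] [Module K M] [Module k M] [IsScalarTower k K M]
    (σ : (K ≃ₐ[k] K) → M →+ M) (hσ : ∀ s (c : K) x, σ s (c • x) = s c • σ s x)
    (h1 : ∀ x, σ 1 x = x) (hmul : ∀ s t x, σ (s * t) x = σ s (σ t x)) :
    ∃ (N : Submodule k M) (f : K ⊗[k] N ≃ₗ[K] M), (∀ s, ∀ y ∈ N, σ s y = y) ∧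
      ∀ (c : K) (y : N), f (c ⊗ₜ y) = c • (y : M) := by
  classical
  have hσk : ∀ s (c : k) x, σ s (c • x) = c • σ s x := by
    intro s c x
    rw [← algebraMap_smul K c x, hσ, AlgEquiv.commutes, algebraMap_smul]
  let N : Submodule k M :=
    { carrier := {x | ∀ s, σ s x = x}
      add_mem' := fun {a b} ha hb s => by rw [map_add, ha s, hb s]
      zero_mem' := fun s => map_zero _
      smul_mem' := fun c x hx s => by rw [hσk, hx s] }
  have hN : ∀ s, ∀ y ∈ N, σ s y = y := fun s y hy => hy s
  obtain ⟨n, l, m, hlm, hd⟩ := aux_dual_basis k K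
  let g : K ⊗[k] N →ₗ[K] M := LinearMap.liftBaseChangeEquiv K N.subtype
  have hg : ∀ (c : K) (y : N), g (c ⊗ₜ y) = c • (y : M) := fun c y => by
    simp [g]
  have htr : ∀ x, (∑ s, σ s x) ∈ N := by
    intro x s
    rw [map_sum]
    simp only [← hmul]
    exact Fintype.sum_equiv (Equiv.mulLeft s) _ _ fun t => rfl
  have hsurj : Function.Surjective g := by
    intro x
    refine ⟨∑ i, m i ⊗ₜ ⟨∑ s, σ s (l i • x), htr _⟩, ?_⟩
    simp only [map_sum, hg, hσ, Finset.smul_sum, smul_smul]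
    rw [Finset.sum_comm]
    simp only [← Finset.sum_smul, hd]
    simp [h1]
  have hinj : Function.Injective g := by
    let r : K ⊗[k] N → K ⊗[k] N := fun z => ∑ i, m i ⊗ₜ ⟨∑ s, σ s (l i • g z), htr _⟩
    have hr : ∀ z, r z = z := by
      intro z
      induction z using TensorProduct.induction_on with
      | zero =>
        refine Finset.sum_eq_zero fun i _ => ?_
        have : (⟨∑ s, σ s (l i • g 0), htr _⟩ : N) = 0 := by ext; simp
        rw [this, TensorProduct.tmul_zero]
      | tmul c y =>
        have : ∀ i, (⟨∑ s, σ s (l i • g (c ⊗ₜ y)), htr _⟩ : N) =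
            Algebra.trace k K (l i * c) • y := by
          intro i
          ext
          simp only [hg, smul_smul]
          exact aux_sum_mem σ hσ N hN _ _ y.2
        simp only [r, this, TensorProduct.tmul_smul, TensorProduct.smul_tmul']
        rw [← TensorProduct.sum_tmul, hlm]
      | add a b ha hb =>
        conv_rhs => rw [← ha, ← hb]
        simp only [r]
        rw [← Finset.sum_add_distrib]
        refine Finset.sum_congr rfl fun i _ => ?_
        rw [← TensorProduct.tmul_add]
        congr 1
        ext
        simp [Finset.sum_add_distrib]
    intro a b hab
    rw [← hr a, ← hr b]
    simp only [r, hab]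
  exact ⟨N, LinearEquiv.ofBijective g ⟨hinj, hsurj⟩, hN, hg⟩

end AuxDescent

section AuxTensor

variable {F : Type u} [Field F] {p q : ℕ}
  {W W' W'' : Type u} [AddCommGroup W] [Module F W] [AddCommGroup W'] [Module F W']
  [AddCommGroup W''] [Module F W'']

/-- Pure tensors. -/
def auxTprod (m : ∀ i, TensorFactor F W p q i) : TensorSpace F W p q :=
  PiTensorProduct.tprod F m

lemma auxTprod_induction {motive : TensorSpace F W p q → Prop} (z : TensorSpace F W p q)
    (h : ∀ (r : F) m, motive (r • auxTprod m))
    (hadd : ∀ x y, motive x → motive y → motive (x + y)) : motive z :=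
  PiTensorProduct.induction_on z h hadd

/-- The factorwise map induced by a linear equivalence. -/
def auxFactorCongr (e : W ≃ₗ[F] W') :
    ∀ i, TensorFactor F W p q i ≃ₗ[F] TensorFactor F W' p q i
  | Sum.inl _ => e
  | Sum.inr _ => e.symm.dualMap

lemma tensorCongr_auxTprod (e : W ≃ₗ[F] W') (m : ∀ i, TensorFactor F W p q i) :
    tensorCongr e (auxTprod m) = auxTprod (fun i => auxFactorCongr e i (m i)) := by
  refine (PiTensorProduct.congr_tprod _ _).trans ?_
  refine congrArg (PiTensorProduct.tprod F) ?_
  funext i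
  cases i <;> rfl

lemma tensorCongr_refl (x : TensorSpace F W p q) :
    tensorCongr (LinearEquiv.refl F W) x = x := by
  induction x using auxTprod_induction with
  | h r m =>
    rw [map_smul, tensorCongr_auxTprod]
    congr 2
    funext i
    cases i <;> rfl
  | hadd x y hx hy => rw [map_add, hx, hy]

lemma tensorCongr_trans (e : W ≃ₗ[F] W') (e' : W' ≃ₗ[F] W'') (x : TensorSpace F W p q) :
    tensorCongr (e.trans e') x = tensorCongr e' (tensorCongr e x) := by
  induction x using auxTprod_induction with
  | h r m =>
    rw [map_smul, map_smul, map_smul, tensorCongr_auxTprod, tensorCongr_auxTprod,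
      tensorCongr_auxTprod]
    congr 2
    funext i
    cases i <;> rfl
  | hadd x y hx hy => rw [map_add, map_add, map_add, hx, hy]

lemma tensorCongr_symm_of_eq (e : W ≃ₗ[F] W') (x : TensorSpace F W p q)
    (y : TensorSpace F W' p q) (h : tensorCongr e x = y) : tensorCongr e.symm y = x := by
  rw [← h, ← tensorCongr_trans, LinearEquiv.self_trans_symm, tensorCongr_refl]

end AuxTensor

section AuxGal

variable {k K : Type u} [Field k] [Field K] [Algebra k K]
variable {V W : Type u} [AddCommGroup V] [Module k V] [AddCommGroup W] [Module k W]
variable {p q : ℕ}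

/-- Twist of a module. -/
def AuxTw (_ : K ≃ₐ[k] K) (M : Type u) : Type u := M

instance (s : K ≃ₐ[k] K) (M : Type u) [AddCommGroup M] : AddCommGroup (AuxTw s M) :=
  inferInstanceAs (AddCommGroup M)

instance (s : K ≃ₐ[k] K) (M : Type u) [AddCommGroup M] [Module K M] : Module K (AuxTw s M) :=
  Module.compHom M (s : K →+* K)

lemma auxTw_smul (s : K ≃ₐ[k] K) (M : Type u) [AddCommGroup M] [Module K M] (c : K) (x : M) :
    (c • (show AuxTw s M from x) : AuxTw s M) = (show AuxTw s M from (s c • x : M)) := rfl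

/-- The Galois action on functionals. -/
def auxDualAct (s : K ≃ₐ[k] K) : Module.Dual K (K ⊗[k] V) →+ Module.Dual K (K ⊗[k] V) where
  toFun φ :=
    { toFun := fun x => s (φ (galAct s.symm x))
      map_add' := fun x y => by simp
      map_smul' := fun c x => by simp [galAct_smul] }
  map_zero' := by ext; simp
  map_add' φ ψ := by ext; simp

lemma auxDualAct_apply (s : K ≃ₐ[k] K) (φ : Module.Dual K (K ⊗[k] V)) (x : K ⊗[k] V) :
    auxDualAct s φ x = s (φ (galAct s.symm x)) := rfl

/-- The Galois action on factors. -/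
def auxFactorAct (s : K ≃ₐ[k] K) :
    ∀ i, TensorFactor K (K ⊗[k] V) p q i →+ TensorFactor K (K ⊗[k] V) p q i
  | Sum.inl _ => ((galAct s : K ⊗[k] V ≃ₗ[k] K ⊗[k] V) : (K ⊗[k] V) →ₗ[k] (K ⊗[k] V)).toAddMonoidHom
  | Sum.inr _ => auxDualAct s

lemma auxFactorAct_smul (s : K ≃ₐ[k] K) (i) (c : K) (x : TensorFactor K (K ⊗[k] V) p q i) :
    auxFactorAct s i (c • x) = s c • auxFactorAct s i x := by
  cases i with
  | inl i => exact galAct_smul s c x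
  | inr i =>
    refine LinearMap.ext fun y => ?_
    exact map_mul s _ _

lemma auxTprod_add [DecidableEq (Fin p ⊕ Fin q)] (s : K ≃ₐ[k] K)
    (m : ∀ i, TensorFactor K (K ⊗[k] V) p q i) (i) (x y : TensorFactor K (K ⊗[k] V) p q i) :
    auxTprod (fun j => auxFactorAct s j (Function.update m i (x + y) j)) =
      auxTprod (fun j => auxFactorAct s j (Function.update m i x j)) +
      auxTprod (fun j => auxFactorAct s j (Function.update m i y j)) := by
  have h : ∀ z, (fun j => auxFactorAct s j (Function.update m i z j)) =
      Function.update (fun j => auxFactorAct s j (m j)) i (auxFactorAct s i z) :=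
    fun z => funext fun j => Function.apply_update (fun j => ⇑(auxFactorAct s j)) m i z j
  rw [h, h, h, map_add]
  exact (PiTensorProduct.tprod K).map_update_add _ _ _ _

lemma auxTprod_smul [DecidableEq (Fin p ⊕ Fin q)] (s : K ≃ₐ[k] K)
    (m : ∀ i, TensorFactor K (K ⊗[k] V) p q i) (i) (c : K)
    (x : TensorFactor K (K ⊗[k] V) p q i) :
    auxTprod (fun j => auxFactorAct s j (Function.update m i (c • x) j)) =
      s c • auxTprod (fun j => auxFactorAct s j (Function.update m i x j)) := by
  have h : ∀ z, (fun j => auxFactorAct s j (Function.update m i z j)) =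
      Function.update (fun j => auxFactorAct s j (m j)) i (auxFactorAct s i z) :=
    fun z => funext fun j => Function.apply_update (fun j => ⇑(auxFactorAct s j)) m i z j
  rw [h, h, auxFactorAct_smul]
  exact (PiTensorProduct.tprod K).map_update_smul _ _ _ _

/-- The multilinear map behind the Galois action on tensors. -/
def auxMulti (s : K ≃ₐ[k] K) :
    MultilinearMap K (TensorFactor K (K ⊗[k] V) p q) (AuxTw s (TensorSpace K (K ⊗[k] V) p q)) where
  toFun m := auxTprod fun i => auxFactorAct s i (m i)
  map_update_add' m i x y := auxTprod_add s m i x y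
  map_update_smul' m i c x := auxTprod_smul s m i c x

/-- The Galois action on tensors. -/
def auxTensAct (s : K ≃ₐ[k] K) :
    TensorSpace K (K ⊗[k] V) p q →+ TensorSpace K (K ⊗[k] V) p q :=
  (PiTensorProduct.lift (auxMulti (p := p) (q := q) (V := V) s)).toAddMonoidHom

lemma auxTensAct_smul (s : K ≃ₐ[k] K) (c : K) (x : TensorSpace K (K ⊗[k] V) p q) :
    auxTensAct s (c • x) = s c • auxTensAct s x := by
  have h := LinearMap.map_smul (PiTensorProduct.lift (auxMulti (p := p) (q := q) (V := V) s)) c x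
  exact h

lemma auxTensAct_tprod (s : K ≃ₐ[k] K) (m : ∀ i, TensorFactor K (K ⊗[k] V) p q i) :
    auxTensAct s (auxTprod m) = auxTprod fun i => auxFactorAct s i (m i) := by
  have h := PiTensorProduct.lift.tprod (φ := auxMulti (p := p) (q := q) (V := V) s) m
  exact h

lemma galConj_apply (s : K ≃ₐ[k] K) (f : (K ⊗[k] V) ≃ₗ[K] (K ⊗[k] W)) (x) :
    galConj s f x = galAct s (f (galAct s.symm x)) := rfl

lemma galConj_symm_apply (s : K ≃ₐ[k] K) (f : (K ⊗[k] V) ≃ₗ[K] (K ⊗[k] W)) (x) :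
    (galConj s f).symm x = galAct s (f.symm (galAct s.symm x)) := rfl

lemma aux_f1 (s : K ≃ₐ[k] K) (f : (K ⊗[k] V) ≃ₗ[K] (K ⊗[k] W)) (y : K ⊗[k] V) :
    galAct s (f y) = galConj s f (galAct s y) := by
  rw [galConj_apply, galAct_galAct']

lemma aux_f2 (s : K ≃ₐ[k] K) (f : (K ⊗[k] V) ≃ₗ[K] (K ⊗[k] W)) (y : Module.Dual K (K ⊗[k] V)) :
    auxDualAct s (f.symm.dualMap y) = (galConj s f).symm.dualMap (auxDualAct s y) := by
  refine LinearMap.ext fun z => ?_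
  rw [auxDualAct_apply, LinearEquiv.dualMap_apply, LinearEquiv.dualMap_apply, auxDualAct_apply,
    galConj_symm_apply, galAct_galAct']

lemma auxTensAct_congr (s : K ≃ₐ[k] K) (f : (K ⊗[k] V) ≃ₗ[K] (K ⊗[k] W))
    (x : TensorSpace K (K ⊗[k] V) p q) :
    auxTensAct s (tensorCongr f x) = tensorCongr (galConj s f) (auxTensAct s x) := by
  induction x using auxTprod_induction with
  | h r m =>
    rw [map_smul, auxTensAct_smul, auxTensAct_smul, map_smul, tensorCongr_auxTprod,
      auxTensAct_tprod, auxTensAct_tprod, tensorCongr_auxTprod]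
    congr 2
    funext i
    generalize m i = y
    cases i with
    | inl i => exact aux_f1 s f y
    | inr i => exact aux_f2 s f y
  | hadd x y hx hy => rw [map_add, map_add, map_add, map_add, hx, hy]

lemma tensorBC_tprod (m : ∀ i, TensorFactor k V p q i) :
    tensorBC k K V p q (auxTprod m) = auxTprod fun i => factorBC k K V p q i (m i) :=
  PiTensorProduct.lift.tprod _

lemma dualBC_apply_tmul (φ : Module.Dual k V) (c : K) (v : V) :
    dualBC k K V φ (c ⊗ₜ v) = c * algebraMap k K (φ v) := by
  simp [dualBC]

instance : IsScalarTower k K (TensorSpace K (K ⊗[k] V) p q) :=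
  inferInstanceAs (IsScalarTower k K (⨂[K] i : Fin p ⊕ Fin q, TensorFactor K (K ⊗[k] V) p q i))

lemma aux_f3 (s : K ≃ₐ[k] K) (y : Module.Dual k V) :
    auxDualAct s (dualBC k K V y) = dualBC k K V y := by
  refine LinearMap.ext fun z => ?_
  rw [auxDualAct_apply]
  induction z using TensorProduct.induction_on with
  | zero => simp
  | tmul c v => rw [galAct_tmul, dualBC_apply_tmul, dualBC_apply_tmul]; simp
  | add a b ha hb => simp only [map_add, ha, hb]

lemma aux_f4 (e : V ≃ₗ[k] W) (y : Module.Dual k V) :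
    (e.baseChange k K V W).symm.dualMap (dualBC k K V y) = dualBC k K W (e.symm.dualMap y) := by
  refine LinearMap.ext fun z => ?_
  rw [LinearEquiv.dualMap_apply]
  induction z using TensorProduct.induction_on with
  | zero => simp
  | tmul c v =>
    have : (e.baseChange k K V W).symm (c ⊗ₜ v) = c ⊗ₜ e.symm v := rfl
    rw [this, dualBC_apply_tmul, dualBC_apply_tmul, LinearEquiv.dualMap_apply]
  | add a b ha hb => simp only [map_add, ha, hb]

lemma auxTensAct_BC (s : K ≃ₐ[k] K) (x : TensorSpace k V p q) :
    auxTensAct s (tensorBC k K V p q x) = tensorBC k K V p q x := by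
  induction x using auxTprod_induction with
  | h r m =>
    rw [map_smul, ← algebraMap_smul K r, auxTensAct_smul, AlgEquiv.commutes, tensorBC_tprod,
      auxTensAct_tprod]
    congr 2
    funext i
    generalize m i = y
    cases i with
    | inl i =>
      exact congrArg (fun c : K => c ⊗ₜ[k] (y : V)) (map_one s)
    | inr i =>
      exact aux_f3 s y
  | hadd x y hx hy => rw [map_add, map_add, hx, hy]

lemma tensorCongr_BC (e : V ≃ₗ[k] W) (x : TensorSpace k V p q) :
    tensorCongr (e.baseChange k K V W) (tensorBC k K V p q x) =
      tensorBC k K W p q (tensorCongr e x) := by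
  induction x using auxTprod_induction with
  | h r m =>
    rw [map_smul, map_smul (tensorCongr e), map_smul (tensorBC k K W p q), ← algebraMap_smul K r (tensorBC k K V p q _),
      ← algebraMap_smul K r (tensorBC k K W p q _), map_smul, tensorBC_tprod, tensorCongr_auxTprod, tensorCongr_auxTprod, tensorBC_tprod]
    congr 2
    funext i
    generalize m i = y
    cases i with
    | inl i => rfl
    | inr i =>
      exact aux_f4 e y
  | hadd x y hx hy => rw [map_add, map_add, map_add, map_add, hx, hy]

end AuxGal

section AuxBasis

variable {k K : Type u} [Field k] [Field K] [Algebra k K]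
variable {V : Type u} [AddCommGroup V] [Module k V] [FiniteDimensional k V]
variable {p q : ℕ}

lemma aux_basis : ∃ (κ : Type) (B : Module.Basis κ k (TensorSpace k V p q))
    (B' : Module.Basis κ K (TensorSpace K (K ⊗[k] V) p q)),
      ∀ j, tensorBC k K V p q (B j) = B' j := by
  classical
  let b := Module.finBasis k V
  let n := Module.finrank k V
  let c : ∀ i : Fin p ⊕ Fin q, Module.Basis (Fin n) k (TensorFactor k V p q i) := fun i =>
    match i with
    | Sum.inl _ => b
    | Sum.inr _ => b.dualBasis
  let c' : ∀ i : Fin p ⊕ Fin q, Module.Basis (Fin n) K (TensorFactor K (K ⊗[k] V) p q i) :=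
    fun i =>
    match i with
    | Sum.inl _ => b.baseChange K
    | Sum.inr _ => (b.baseChange K).dualBasis
  refine ⟨_, Basis.piTensorProduct c, Basis.piTensorProduct c', fun j => ?_⟩
  have h1 : Basis.piTensorProduct c j = auxTprod fun i => c i (j i) :=
    Basis.piTensorProduct_apply _ _
  have h2 : Basis.piTensorProduct c' j = auxTprod fun i => c' i (j i) :=
    Basis.piTensorProduct_apply _ _
  refine (congrArg _ h1).trans (Eq.trans ?_ h2.symm)
  rw [tensorBC_tprod]
  congr 1
  funext i
  generalize j i = y
  cases i with
  | inl i => exact (b.baseChange_apply K y).symm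
  | inr i =>
    change dualBC k K V (b.dualBasis y) = (b.baseChange K).dualBasis y
    refine (b.baseChange K).ext fun z => ?_
    rw [Module.Basis.baseChange_apply, dualBC_apply_tmul]
    rw [← b.baseChange_apply K]
    simp [Finsupp.single_apply]
    
lemma tensorBC_injective : Function.Injective (tensorBC k K V p q) := by
  obtain ⟨κ, B, B', h⟩ := aux_basis (k := k) (K := K) (V := V) (p := p) (q := q)
  have hli : LinearIndependent k (fun j => tensorBC k K V p q (B j)) := by
    simp only [h]
    exact LinearIndependent.restrict_scalars' (K := K) k B'.linearIndependent
  exact LinearMap.injective_of_linearIndependent B.span_eq hli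

lemma tensorBC_span (z : TensorSpace K (K ⊗[k] V) p q) :
    z ∈ Submodule.span K ((LinearMap.range (tensorBC k K V p q) : Submodule k _) :
      Set (TensorSpace K (K ⊗[k] V) p q)) := by
  obtain ⟨κ, B, B', h⟩ := aux_basis (k := k) (K := K) (V := V) (p := p) (q := q)
  refine Submodule.span_mono ?_ (B'.mem_span z)
  rintro _ ⟨j, rfl⟩
  exact ⟨B j, h j⟩

lemma tensorBC_of_fixed [IsGalois k K] [FiniteDimensional k K]
    (z : TensorSpace K (K ⊗[k] V) p q) (hz : ∀ s : K ≃ₐ[k] K, auxTensAct s z = z) :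
    ∃ y, tensorBC k K V p q y = z := by
  refine aux_fixed_mem (fun s : K ≃ₐ[k] K => auxTensAct s) auxTensAct_smul
    (LinearMap.range (tensorBC k K V p q)) ?_ tensorBC_span z hz
  rintro s _ ⟨y, rfl⟩
  exact auxTensAct_BC s y

end AuxBasis

section AuxConj

variable {k K : Type u} [Field k] [Field K] [Algebra k K]
variable {V W U : Type u} [AddCommGroup V] [Module k V] [AddCommGroup W] [Module k W]
  [AddCommGroup U] [Module k U]

lemma aux_galAct_one (x : K ⊗[k] V) : galAct (1 : K ≃ₐ[k] K) x = x := by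
  induction x using TensorProduct.induction_on with
  | zero => simp
  | tmul a v => rfl
  | add x y hx hy => simp [map_add, hx, hy]

lemma aux_galAct_mul (s t : K ≃ₐ[k] K) (x : K ⊗[k] V) :
    galAct (s * t) x = galAct s (galAct t x) := by
  induction x using TensorProduct.induction_on with
  | zero => simp
  | tmul a v => rfl
  | add x y hx hy => simp [map_add, hx, hy]

lemma aux_galAct_mul_symm (s t : K ≃ₐ[k] K) (x : K ⊗[k] V) :
    galAct (s * t).symm x = galAct t.symm (galAct s.symm x) := by
  have : (s * t).symm = t.symm * s.symm := rfl
  rw [this, aux_galAct_mul]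

lemma aux_galAct_baseChange (s : K ≃ₐ[k] K) (e : V ≃ₗ[k] W) (x : K ⊗[k] V) :
    galAct s (e.baseChange k K V W x) = e.baseChange k K V W (galAct s x) := by
  induction x using TensorProduct.induction_on with
  | zero => simp
  | tmul a v => rfl
  | add x y hx hy => simp [map_add, hx, hy]

lemma aux_galConj_mul (s : K ≃ₐ[k] K) (a b : (K ⊗[k] V) ≃ₗ[K] (K ⊗[k] V)) :
    galConj s (a * b) = galConj s a * galConj s b := by
  ext x
  simp only [LinearEquiv.mul_apply, galConj_apply, galAct_galAct']

lemma aux_galConj_one (s : K ≃ₐ[k] K) :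
    galConj s (1 : (K ⊗[k] V) ≃ₗ[K] (K ⊗[k] V)) = 1 := by
  refine LinearEquiv.ext fun x => ?_
  rw [galConj_apply]
  exact galAct_galAct s x

lemma aux_galConj_inv (s : K ≃ₐ[k] K) (a : (K ⊗[k] V) ≃ₗ[K] (K ⊗[k] V)) :
    galConj s a⁻¹ = (galConj s a)⁻¹ := rfl

lemma aux_congr_galConj {p q : ℕ} (s : K ≃ₐ[k] K) (f : (K ⊗[k] V) ≃ₗ[K] (K ⊗[k] W))
    (x : TensorSpace k V p q) (y : TensorSpace k W p q)
    (h : tensorCongr f (tensorBC k K V p q x) = tensorBC k K W p q y) :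
    tensorCongr (galConj s f) (tensorBC k K V p q x) = tensorBC k K W p q y := by
  rw [← auxTensAct_BC s x, ← auxTensAct_congr, h, auxTensAct_BC]

lemma aux_incl_injective : Function.Injective (inclBC k K V) := by
  have := Module.FaithfullyFlat.tensorProduct_mk_injective (A := k) (B := K) V
  exact this

lemma aux_incl_fixed [IsGalois k K] [FiniteDimensional k K] (x : K ⊗[k] V)
    (hx : ∀ s : K ≃ₐ[k] K, galAct s x = x) : ∃ v, inclBC k K V v = x := by
  refine aux_fixed_mem (fun s : K ≃ₐ[k] K =>
    ((galAct s : K ⊗[k] V ≃ₗ[k] K ⊗[k] V) : (K ⊗[k] V) →ₗ[k] (K ⊗[k] V)).toAddMonoidHom)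
    galAct_smul (LinearMap.range (inclBC k K V)) ?_ ?_ x hx
  · rintro s _ ⟨v, rfl⟩
    exact congrArg (fun c : K => c ⊗ₜ[k] (v : V)) (map_one s)
  · intro z
    induction z using TensorProduct.induction_on with
    | zero => exact Submodule.zero_mem _
    | tmul a v =>
      have : a ⊗ₜ[k] v = a • inclBC k K V v := by
        simp [inclBC, TensorProduct.smul_tmul']
      rw [this]
      exact Submodule.smul_mem _ _ (Submodule.subset_span ⟨v, rfl⟩)
    | add x y hx hy => exact Submodule.add_mem _ hx hy

lemma aux_descend_map [IsGalois k K] [FiniteDimensional k K]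
    (f : (K ⊗[k] V) ≃ₗ[K] (K ⊗[k] W)) (hf : ∀ s : K ≃ₐ[k] K, galConj s f = f) :
    ∃ e : V →ₗ[k] W, ∀ v, inclBC k K W (e v) = f (inclBC k K V v) := by
  have h : ∀ v, ∃ w, inclBC k K W w = f (inclBC k K V v) := by
    intro v
    refine aux_incl_fixed _ fun s => ?_
    conv_rhs => rw [← hf s, galConj_apply]
    congr 2
    exact (congrArg (fun c : K => c ⊗ₜ[k] (v : V)) (map_one s.symm)).symm
  choose e he using h
  refine ⟨{ toFun := e, map_add' := ?_, map_smul' := ?_ }, he⟩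
  · intro x y
    apply aux_incl_injective (k := k) (K := K)
    simp only [map_add, he]
  · intro c x
    apply aux_incl_injective (k := k) (K := K)
    rw [he, map_smul (inclBC k K V), RingHom.id_apply, map_smul (inclBC k K W), he, ← algebraMap_smul K c (inclBC k K V x),
      map_smul, algebraMap_smul]

lemma aux_descend_equiv [IsGalois k K] [FiniteDimensional k K]
    (f : (K ⊗[k] V) ≃ₗ[K] (K ⊗[k] W)) (hf : ∀ s : K ≃ₐ[k] K, galConj s f = f) :
    ∃ e : V ≃ₗ[k] W, f = e.baseChange k K V W := by
  obtain ⟨e, he⟩ := aux_descend_map f hf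
  obtain ⟨e', he'⟩ := aux_descend_map f.symm (fun s => by
    conv_rhs => rw [← hf s]
    rfl)
  refine ⟨LinearEquiv.ofLinearMap e e' ?_ ?_, ?_⟩
  · ext v
    apply aux_incl_injective (k := k) (K := K)
    simp [he, he']
  · ext v
    apply aux_incl_injective (k := k) (K := K)
    simp [he, he']
  · refine LinearEquiv.ext fun x => ?_
    induction x using TensorProduct.induction_on with
    | zero => simp
    | tmul a v =>
      have : a ⊗ₜ[k] v = a • inclBC k K V v := by
        simp [inclBC, TensorProduct.smul_tmul']
      rw [this, map_smul, map_smul, ← he]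
      rfl
    | add x y hx hy => rw [map_add, map_add, hx, hy]

end AuxConj

section AuxMain

variable {k K : Type u} [Field k] [Field K] [Algebra k K]
variable {V : Type u} [AddCommGroup V] [Module k V]
variable {ι : Type u} {p q : ι → ℕ}

lemma aux_cocycle (T : ∀ i : ι, TensorSpace k V (p i) (q i)) (P : TensorFamilyPair k ι p q)
    (f : (K ⊗[k] V) ≃ₗ[K] (K ⊗[k] P.carrier)) (hf : IsTensorIsoK k K V ι p q T P f) :
    IsTensorCocycle k K V ι p q T (fun s => (galConj s f).trans f.symm) := by
  refine ⟨fun s i => ?_, fun s t => ?_⟩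
  · rw [tensorCongr_trans, aux_congr_galConj s f _ _ (hf i)]
    exact tensorCongr_symm_of_eq _ _ _ (hf i)
  · refine LinearEquiv.ext fun x => ?_
    simp only [LinearEquiv.mul_apply, LinearEquiv.trans_apply, galConj_apply, galAct_galAct',
      aux_galAct_mul, aux_galAct_mul_symm, LinearEquiv.apply_symm_apply]

lemma aux_wd (T : ∀ i : ι, TensorSpace k V (p i) (q i)) (P P' : TensorFamilyPair k ι p q)
    (f : (K ⊗[k] V) ≃ₗ[K] (K ⊗[k] P.carrier)) (hf : IsTensorIsoK k K V ι p q T P f)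
    (g : (K ⊗[k] V) ≃ₗ[K] (K ⊗[k] P'.carrier)) (hg : IsTensorIsoK k K V ι p q T P' g)
    (h : kIsomorphic k P P') :
    TensorCohomologous k K V ι p q T (fun s => (galConj s f).trans f.symm)
      (fun s => (galConj s g).trans g.symm) := by
  obtain ⟨e, he⟩ := h
  refine ⟨g.trans ((e.baseChange k K _ _).symm.trans f.symm), fun i => ?_, fun s => ?_⟩
  · rw [tensorCongr_trans, tensorCongr_trans, hg i]
    refine tensorCongr_symm_of_eq _ _ _ ?_
    rw [hf i]
    refine (tensorCongr_symm_of_eq _ _ _ ?_).symm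
    rw [tensorCongr_BC, he]
  · refine LinearEquiv.ext fun x => ?_
    simp only [LinearEquiv.mul_apply]
    rw [show ∀ y, (g.trans ((e.baseChange k K _ _).symm.trans f.symm))⁻¹ y =
      g.symm (e.baseChange k K _ _ (f y)) from fun y => rfl]
    simp only [LinearEquiv.trans_apply, galConj_apply, galAct_galAct',
      LinearEquiv.apply_symm_apply, ← aux_galAct_baseChange]

lemma aux_inj [IsGalois k K] [FiniteDimensional k K]
    (T : ∀ i : ι, TensorSpace k V (p i) (q i)) (P P' : TensorFamilyPair k ι p q)
    (f : (K ⊗[k] V) ≃ₗ[K] (K ⊗[k] P.carrier)) (hf : IsTensorIsoK k K V ι p q T P f)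
    (g : (K ⊗[k] V) ≃ₗ[K] (K ⊗[k] P'.carrier)) (hg : IsTensorIsoK k K V ι p q T P' g)
    (h : TensorCohomologous k K V ι p q T (fun s => (galConj s f).trans f.symm)
      (fun s => (galConj s g).trans g.symm)) : kIsomorphic k P P' := by
  obtain ⟨c, hc, h⟩ := h
  obtain ⟨e, he⟩ := aux_descend_equiv (f.symm.trans (c.symm.trans g)) (fun s => by
    refine LinearEquiv.ext fun x => ?_
    have h2 := LinearEquiv.congr_fun (h s) (galAct s (c.symm (f.symm (galAct s.symm x))))
    simp only [LinearEquiv.mul_apply] at h2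
    rw [show ∀ y, c⁻¹ y = c.symm y from fun y => rfl] at h2
    simp only [LinearEquiv.trans_apply, galConj_apply, galAct_galAct',
      LinearEquiv.apply_symm_apply, galAct_galAct] at h2
    simp only [LinearEquiv.trans_apply, galConj_apply]
    rw [← h2, LinearEquiv.apply_symm_apply])
  refine ⟨e, fun i => ?_⟩
  apply tensorBC_injective (K := K)
  rw [← tensorCongr_BC, ← he, tensorCongr_trans, tensorCongr_trans, ← hg i,
    tensorCongr_symm_of_eq _ _ _ (hf i), tensorCongr_symm_of_eq _ _ _ (hc i)]

lemma aux_surj [IsGalois k K] [FiniteDimensional k K] [FiniteDimensional k V]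
    (T : ∀ i : ι, TensorSpace k V (p i) (q i))
    (a : (K ≃ₐ[k] K) → ((K ⊗[k] V) ≃ₗ[K] (K ⊗[k] V))) (ha : IsTensorCocycle k K V ι p q T a) :
    ∃ (P : TensorFamilyPair k ι p q) (f : (K ⊗[k] V) ≃ₗ[K] (K ⊗[k] P.carrier)),
      IsTensorIsoK k K V ι p q T P f ∧ (fun s => (galConj s f).trans f.symm) = a := by
  obtain ⟨hT, hm⟩ := ha
  have h1 : a 1 = 1 := by
    have h := hm 1 1
    have h2 : galConj 1 (a 1) = a 1 := by
      refine LinearEquiv.ext fun x => ?_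
      rw [galConj_apply, aux_galAct_one]
      exact congrArg _ (aux_galAct_one x)
    rw [h2, mul_one] at h
    exact left_eq_mul.mp h
  obtain ⟨N, g, hN, hg⟩ := aux_descent (k := k) (K := K) (M := K ⊗[k] V)
    (fun s : K ≃ₐ[k] K => (a s).toLinearMap.toAddMonoidHom.comp
      ((galAct s : K ⊗[k] V ≃ₗ[k] K ⊗[k] V) : (K ⊗[k] V) →ₗ[k] (K ⊗[k] V)).toAddMonoidHom)
    (fun s c x => by
      change a s (galAct s (c • x)) = s c • a s (galAct s x)
      rw [galAct_smul, map_smul])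
    (fun x => by
      change a 1 (galAct 1 x) = x
      rw [h1, aux_galAct_one]; rfl)
    (fun s t x => by
      change a (s * t) (galAct (s * t) x) = a s (galAct s (a t (galAct t x)))
      rw [hm, LinearEquiv.mul_apply, galConj_apply, aux_galAct_mul, galAct_galAct'])
  replace hN : ∀ s, ∀ y ∈ N, a s (galAct s y) = y := hN
  have hcomm : ∀ (s : K ≃ₐ[k] K) (x : K ⊗[k] N),
      a s (galAct s (g x)) = g (galAct (V := N) s x) := by
    intro s x
    induction x using TensorProduct.induction_on with
    | zero => simp
    | tmul c v => rw [hg, galAct_tmul, hg, galAct_smul, map_smul, hN s v v.2]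
    | add x y hx hy => simp only [map_add, hx, hy]
  have hconj : ∀ s, galConj s g.symm = (a s).trans g.symm := by
    intro s
    refine LinearEquiv.ext fun x => ?_
    rw [galConj_apply, LinearEquiv.trans_apply, LinearEquiv.eq_symm_apply, ← hcomm,
      LinearEquiv.apply_symm_apply, galAct_galAct]
  have hy : ∀ i, ∃ y, tensorBC k K N (p i) (q i) y =
      tensorCongr g.symm (tensorBC k K V (p i) (q i) (T i)) := by
    intro i
    refine tensorBC_of_fixed _ fun s => ?_
    rw [auxTensAct_congr, hconj, tensorCongr_trans, auxTensAct_BC, hT]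
  choose y hy using hy
  refine ⟨{ carrier := N, tensor := y }, g.symm, fun i => (hy i).symm, ?_⟩
  funext s
  rw [hconj]
  refine LinearEquiv.ext fun x => ?_
  simp

lemma aux_coh_equiv (T : ∀ i : ι, TensorSpace k V (p i) (q i)) :
    Equivalence (fun a b : {a : (K ≃ₐ[k] K) → ((K ⊗[k] V) ≃ₗ[K] (K ⊗[k] V)) //
      IsTensorCocycle k K V ι p q T a} => TensorCohomologous k K V ι p q T a.1 b.1) where
  refl a := ⟨1, fun i => tensorCongr_refl _, fun s => by simp [aux_galConj_one]⟩
  symm := by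
    rintro a b ⟨c, hc, h⟩
    refine ⟨c⁻¹, fun i => tensorCongr_symm_of_eq _ _ _ (hc i), fun s => ?_⟩
    rw [h, aux_galConj_inv]
    group
  trans := by
    rintro a b d ⟨c, hc, h⟩ ⟨c', hc', h'⟩
    refine ⟨c * c', fun i => ?_, fun s => ?_⟩
    · refine (tensorCongr_trans c' c _).trans ?_
      rw [hc', hc]
    · rw [h', h, aux_galConj_mul]
      group

end AuxMain

section Statement

variable (k K : Type u) [Field k] [Field K] [Algebra k K] [IsGalois k K]
  [FiniteDimensional k K]
variable {V : Type u} [AddCommGroup V] [Module k V] [FiniteDimensional k V]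
variable {ι : Type u} {p q : ι → ℕ}

/-- **Theorem 3.3 of the paper.**  Let `K/k` be a finite Galois extension
with Galois group `G`, `V` a finite-dimensional `k`-vector space and `T` a
family of tensors `x_i` of types `(p_i, q_i)` on `V`.  Let `A_{T,K}` be the
group of `K`-automorphisms of `V_K` fixing `(x_i)_K` for every `i`, with `G`
acting by `f ↦ s(f) = s ∘ f ∘ s⁻¹`.  Then the map
`θ : E_{V,T}(K/k) → H¹(G, A_{T,K})`, sending the class of `(V', T')` to the
class of the 1-cocycle `s ↦ f⁻¹ ∘ s(f)` for any `K`-isomorphism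
`f : (V_K, T_K) → (V'_K, T'_K)`, is well defined and bijective. -/
theorem tensor_family_galois_descent (T : ∀ i : ι, TensorSpace k V (p i) (q i)) :
    ∃ θ : TensorClasses k K V ι p q T → TensorH1 k K V ι p q T,
      Function.Bijective θ ∧
      ∀ (P : TensorFamilyPair k ι p q) (hP : BecomesIsomorphic k K V ι p q T P)
        (f : (K ⊗[k] V) ≃ₗ[K] (K ⊗[k] P.carrier))
        (_ : IsTensorIsoK k K V ι p q T P f),
        ∃ hcoc : IsTensorCocycle k K V ι p q T (fun s => (galConj s f).trans f.symm),
          θ (Quot.mk _ ⟨P, hP⟩) =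
            Quot.mk _ ⟨fun s => (galConj s f).trans f.symm, hcoc⟩ := by
  classical
  have hex : ∀ P : {P : TensorFamilyPair k ι p q // BecomesIsomorphic k K V ι p q T P},
    ∃ f : (K ⊗[k] V) ≃ₗ[K] (K ⊗[k] P.1.carrier), IsTensorIsoK k K V ι p q T P.1 f :=
    fun P => P.2
  choose F hF using hex
  have hrefl : ∀ P : TensorFamilyPair k ι p q, kIsomorphic k P P :=
    fun P => ⟨LinearEquiv.refl k _, fun i => tensorCongr_refl _⟩
  let θ : TensorClasses k K V ι p q T → TensorH1 k K V ι p q T :=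
    Quot.lift (fun P => Quot.mk _ ⟨fun s => (galConj s (F P)).trans (F P).symm,
      aux_cocycle T P.1 (F P) (hF P)⟩)
      (fun P P' h => Quot.sound (aux_wd T P.1 P'.1 (F P) (hF P) (F P') (hF P') h))
  have hθ : ∀ (P : TensorFamilyPair k ι p q) (hP : BecomesIsomorphic k K V ι p q T P)
        (f : (K ⊗[k] V) ≃ₗ[K] (K ⊗[k] P.carrier))
        (_ : IsTensorIsoK k K V ι p q T P f),
        ∃ hcoc : IsTensorCocycle k K V ι p q T (fun s => (galConj s f).trans f.symm),
          θ (Quot.mk _ ⟨P, hP⟩) =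
            Quot.mk _ ⟨fun s => (galConj s f).trans f.symm, hcoc⟩ := by
    intro P hP f hf
    exact ⟨aux_cocycle T P f hf,
      Quot.sound (aux_wd T P P (F ⟨P, hP⟩) (hF ⟨P, hP⟩) f hf (hrefl P))⟩
  refine ⟨θ, ⟨?_, ?_⟩, hθ⟩
  · rintro ⟨P⟩ ⟨P'⟩ h
    refine Quot.sound ?_
    have h2 := (aux_coh_equiv T).eqvGen_iff.mp (Quot.eqvGen_exact h)
    exact aux_inj T P.1 P'.1 (F P) (hF P) (F P') (hF P') h2
  · rintro ⟨a, ha⟩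
    obtain ⟨P, f, hf, rfl⟩ := aux_surj T a ha
    obtain ⟨hc, h⟩ := hθ P ⟨f, hf⟩ f hf
    exact ⟨Quot.mk _ ⟨P, ⟨f, hf⟩⟩, h⟩

end Statement
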